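/- Multivariate version of the probit normalizer: for w ∈ ℝᵈ with density N(w | m, S) (S positive definite) and any z ∈ ℝᵈ, ∫ ψ(zᵀw) N(w | m, S) dw = ψ( zᵀm / √(1 + zᵀS z) ). -/

import Mathlib

open MeasureTheory Real Matrix

/-- Gaussian density with mean `μ` and variance `v`. -/
noncomputable def gpdf (μ v x : ℝ) : ℝ :=
  (Real.sqrt (2 * Real.pi * v))⁻¹ * Real.exp (-(x - μ) ^ 2 / (2 * v))

/-- Standard normal CDF. -/
noncomputable def stdCDF (t : ℝ) : ℝ := ∫ s in Set.Iic t, gpdf 0 1 s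

/-- Multivariate Gaussian density with mean `m` and covariance `S`. -/
noncomputable def mvgpdf {d : ℕ} (m : Fin d → ℝ) (S : Matrix (Fin d) (Fin d) ℝ)
    (w : Fin d → ℝ) : ℝ :=
  (Real.sqrt ((2 * Real.pi) ^ d * S.det))⁻¹ *
    Real.exp (-(1 / 2) * ((w - m) ⬝ᵥ (S⁻¹ *ᵥ (w - m))))

lemma gpdf_eq (x : ℝ) : gpdf 0 1 x = ProbabilityTheory.gaussianPDFReal 0 1 x := by
  simp [gpdf, ProbabilityTheory.gaussianPDFReal]

lemma stdCDF_eq (t : ℝ) :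
    ENNReal.ofReal (stdCDF t) = ProbabilityTheory.gaussianReal 0 1 (Set.Iic t) := by
  rw [ProbabilityTheory.gaussianReal_apply_eq_integral _ one_ne_zero]
  simp [stdCDF, gpdf_eq]

lemma stdCDF_nonneg (t : ℝ) : 0 ≤ stdCDF t := by
  unfold stdCDF
  refine integral_nonneg fun x => ?_
  rw [gpdf_eq]
  exact ProbabilityTheory.gaussianPDFReal_nonneg _ _ _

lemma stdCDF_measurable : Measurable stdCDF := by
  have h : Monotone stdCDF := by
    intro a b hab
    rw [← ENNReal.ofReal_le_ofReal_iff (stdCDF_nonneg b), stdCDF_eq, stdCDF_eq]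
    exact measure_mono (Set.Iic_subset_Iic.2 hab)
  exact h.measurable

lemma pi_gauss (d : ℕ) :
    Measure.pi (fun _ : Fin d => ProbabilityTheory.gaussianReal 0 1)
      = (volume : Measure (Fin d → ℝ)).withDensity
        (fun x => ENNReal.ofReal (∏ i, ProbabilityTheory.gaussianPDFReal 0 1 (x i))) := by
  refine Measure.pi_eq fun s hs => ?_
  have hnn : ∀ x, 0 ≤ ProbabilityTheory.gaussianPDFReal 0 1 x :=
    fun x => ProbabilityTheory.gaussianPDFReal_nonneg _ _ _
  rw [withDensity_apply _ (MeasurableSet.univ_pi hs), volume_pi, Measure.restrict_pi_pi,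
    ← ofReal_integral_eq_lintegral_ofReal, integral_fintype_prod_eq_prod
      (f := fun _ x => ProbabilityTheory.gaussianPDFReal 0 1 x),
    ENNReal.ofReal_prod_of_nonneg]
  · refine Finset.prod_congr rfl fun i _ => ?_
    rw [ProbabilityTheory.gaussianReal_apply_eq_integral _ one_ne_zero]
  · intro i _
    exact integral_nonneg fun x => hnn x
  · exact Integrable.fintype_prod (f := fun _ x => ProbabilityTheory.gaussianPDFReal 0 1 x)
      fun i => (ProbabilityTheory.integrable_gaussianPDFReal 0 1).restrict
  · exact Filter.Eventually.of_forall fun x => Finset.prod_nonneg fun i _ => hnn _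

lemma map_dot {d : ℕ} (c : Fin d → ℝ) :
    (Measure.pi (fun _ : Fin d => ProbabilityTheory.gaussianReal 0 1)).map (fun u => c ⬝ᵥ u)
      = ProbabilityTheory.gaussianReal 0 (c ⬝ᵥ c).toNNReal := by
  have h := ProbabilityTheory.IsGaussian.map_eq_gaussianReal
    (μ := ProbabilityTheory.stdGaussian (EuclideanSpace ℝ (Fin d)))
    (innerSL ℝ (WithLp.toLp 2 c))
  rw [ProbabilityTheory.integral_strongDual_stdGaussian,
    ProbabilityTheory.variance_dual_stdGaussian, ← ProbabilityTheory.map_pi_eq_stdGaussian,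
    Measure.map_map (by fun_prop) (by fun_prop), innerSL_apply_norm,
    EuclideanSpace.real_norm_sq_eq] at h
  convert h using 2
  · ext u
    simp [dotProduct, PiLp.inner_apply, mul_comm]
  · simp [dotProduct, sq]

lemma gauss_scale (a s : ℝ) (hs : 0 ≤ s) :
    ProbabilityTheory.gaussianReal 0 (1 + s.toNNReal) (Set.Iic a)
      = ENNReal.ofReal (stdCDF (a / √(1 + s))) := by
  have hp : 0 < √(1 + s) := by positivity
  have h := ProbabilityTheory.gaussianReal_map_const_mul (μ := 0) (v := 1) (√(1 + s))
  have h2 : (NNReal.mk ((√(1 + s)) ^ 2) (sq_nonneg _) * 1) = 1 + s.toNNReal := by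
    ext
    simp [Real.sq_sqrt (by positivity : 0 ≤ 1 + s), hs]
  rw [h2, mul_zero] at h
  rw [← h, Measure.map_apply (by fun_prop) measurableSet_Iic, stdCDF_eq]
  congr 1
  ext x
  simp [le_div_iff₀ hp, mul_comm]

lemma core {d : ℕ} (a : ℝ) (c : Fin d → ℝ) :
    ∫ u, stdCDF (a - c ⬝ᵥ u) ∂(Measure.pi (fun _ : Fin d => ProbabilityTheory.gaussianReal 0 1))
      = stdCDF (a / √(1 + c ⬝ᵥ c)) := by
  have hc : 0 ≤ c ⬝ᵥ c := by
    unfold dotProduct; exact Finset.sum_nonneg fun i _ => mul_self_nonneg _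
  have hm : Measurable fun u : Fin d → ℝ => c ⬝ᵥ u := by unfold dotProduct; fun_prop
  have hm2 : Measurable fun x : ℝ => stdCDF (a - x) := stdCDF_measurable.comp (by fun_prop)
  rw [← integral_map (φ := fun u : Fin d → ℝ => c ⬝ᵥ u) (f := fun x => stdCDF (a - x))
    hm.aemeasurable hm2.aestronglyMeasurable, map_dot,
    integral_eq_lintegral_of_nonneg_ae (Filter.Eventually.of_forall fun x => stdCDF_nonneg _)
    hm2.aestronglyMeasurable]
  rw [← ENNReal.toReal_ofReal (stdCDF_nonneg (a / _)), ← gauss_scale _ _ hc]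
  congr 1
  have h := ProbabilityTheory.gaussianReal_conv_gaussianReal
    (m₁ := 0) (m₂ := 0) (v₁ := (c ⬝ᵥ c).toNNReal) (v₂ := 1)
  rw [add_zero, add_comm] at h
  rw [← h, ← lintegral_indicator_one measurableSet_Iic,
    Measure.lintegral_conv (measurable_one.indicator measurableSet_Iic)]
  refine lintegral_congr fun x => ?_
  rw [stdCDF_eq, ← lintegral_indicator_one measurableSet_Iic]
  refine lintegral_congr fun y => ?_
  simp [Set.indicator, le_sub_iff_add_le, add_comm]

open scoped MatrixOrder in
lemma exists_factor {d : ℕ} {S : Matrix (Fin d) (Fin d) ℝ} (hS : S.PosDef) :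
    ∃ A : Matrix (Fin d) (Fin d) ℝ, S = Aᵀ * A := by
  obtain ⟨a, ha⟩ := CStarAlgebra.nonneg_iff_eq_star_mul_self.mp hS.posSemidef.nonneg
  exact ⟨a, by rw [ha, star_eq_conjTranspose, conjTranspose_eq_transpose_of_trivial]⟩

lemma cov {d : ℕ} (B : Matrix (Fin d) (Fin d) ℝ) (hB : B.det ≠ 0) (m : Fin d → ℝ)
    (f : (Fin d → ℝ) → ℝ) :
    ∫ w, f w = ∫ u, f (m - B *ᵥ u) * |B.det| := by
  have h1 := Real.map_matrix_volume_pi_eq_smul_volume_pi hB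
  have hinj : Topology.IsClosedEmbedding (toLin' B) := by
    refine LinearMap.isClosedEmbedding_of_injective ?_
    rw [LinearMap.ker_eq_bot]
    exact Matrix.mulVec_injective_of_isUnit ((Matrix.isUnit_iff_isUnit_det B).2 hB.isUnit)
  have h2 := hinj.measurableEmbedding.integral_map (μ := volume) (fun w => f (m - w))
  rw [h1, integral_smul_measure, integral_sub_left_eq_self (fun w => f w)] at h2
  simp only [toLin'_apply] at h2
  rw [integral_mul_const, ← h2, ENNReal.toReal_ofReal (abs_nonneg _), smul_eq_mul, abs_inv]
  have := abs_pos.2 hB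
  field_simp

/-- multivariate probit normalizer:
`∫ ψ(zᵀw) N(w|m,S) dw = ψ(zᵀm / √(1 + zᵀ S z))` for positive definite `S`. -/
theorem stmt3 {d : ℕ} (m : Fin d → ℝ) (S : Matrix (Fin d) (Fin d) ℝ)
    (hS : S.PosDef) (z : Fin d → ℝ) :
    ∫ w : Fin d → ℝ, stdCDF (z ⬝ᵥ w) * mvgpdf m S w
      = stdCDF ((z ⬝ᵥ m) / Real.sqrt (1 + z ⬝ᵥ (S *ᵥ z))) := by
  obtain ⟨A, hA⟩ := exists_factor hS
  have hdet : S.det = A.det ^ 2 := by rw [hA, det_mul, det_transpose, sq]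
  have hA0 : A.det ≠ 0 := by
    intro h
    have := hS.det_pos
    rw [hdet, h] at this
    simp at this
  have hz : z ⬝ᵥ (S *ᵥ z) = (A *ᵥ z) ⬝ᵥ (A *ᵥ z) := by
    rw [hA, ← mulVec_mulVec, dotProduct_mulVec, vecMul_transpose]
  have hzu : ∀ u, z ⬝ᵥ (Aᵀ *ᵥ u) = (A *ᵥ z) ⬝ᵥ u := by
    intro u
    rw [dotProduct_mulVec, vecMul_transpose]
  have hq : A * S⁻¹ * Aᵀ = 1 := by
    have hu : IsUnit A.det := hA0.isUnit
    have hu' : IsUnit Aᵀ.det := by rwa [det_transpose]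
    rw [hA, Matrix.mul_inv_rev, ← mul_assoc, mul_nonsing_inv _ hu, one_mul, nonsing_inv_mul _ hu']
  rw [cov Aᵀ (by rwa [det_transpose]) m, hz, ← core, pi_gauss,
    integral_withDensity_eq_integral_toReal_smul]
  · refine integral_congr_ae (Filter.Eventually.of_forall fun u => ?_)
    have hnn : ∀ x, 0 ≤ ProbabilityTheory.gaussianPDFReal 0 1 x :=
      fun x => ProbabilityTheory.gaussianPDFReal_nonneg _ _ _
    have hquad : (m - Aᵀ *ᵥ u - m) ⬝ᵥ (S⁻¹ *ᵥ (m - Aᵀ *ᵥ u - m)) = ∑ i, u i ^ 2 := by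
      have : m - Aᵀ *ᵥ u - m = -(Aᵀ *ᵥ u) := by abel
      rw [this, mulVec_neg, neg_dotProduct_neg, mulVec_mulVec, dotProduct_comm,
        dotProduct_mulVec, vecMul_transpose, mulVec_mulVec, ← mul_assoc, hq, one_mulVec]
      simp [dotProduct, sq]
    have hprod : ∏ i, ProbabilityTheory.gaussianPDFReal 0 1 (u i)
        = (√((2 * π) ^ d))⁻¹ * rexp (-(1 / 2) * ∑ i, u i ^ 2) := by
      simp only [ProbabilityTheory.gaussianPDFReal, Finset.prod_mul_distrib, ← Real.exp_sum,
        Finset.prod_const, Finset.card_univ, Fintype.card_fin]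
      congr 1
      · rw [NNReal.coe_one, mul_one, inv_pow]
        congr 1
        refine (Real.sqrt_eq_iff_mul_self_eq (by positivity) (by positivity)).2 ?_ |>.symm
        rw [← mul_pow, Real.mul_self_sqrt (by positivity)]
      · rw [Finset.mul_sum]
        congr 1
        refine Finset.sum_congr rfl fun i _ => ?_
        simp; ring
    simp only [smul_eq_mul]
    rw [ENNReal.toReal_ofReal (Finset.prod_nonneg fun i _ => hnn _), hprod, mvgpdf, hquad,
      dotProduct_sub, hzu, hdet, det_transpose, Real.sqrt_mul (by positivity), Real.sqrt_sq_eq_abs]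
    have := abs_pos.2 hA0
    field_simp
  · refine Measurable.ennreal_ofReal ?_
    refine Finset.measurable_prod _ fun i _ => ?_
    exact (ProbabilityTheory.measurable_gaussianPDFReal 0 1).comp (measurable_pi_apply i)
  · exact Filter.Eventually.of_forall fun x => ENNReal.ofReal_lt_top
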